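/- Suppose ℤ² = ⟨a, t⟩ acts faithfully on I = [0,1] by orientation-preserving C^{1,τ} diffeomorphisms (τ ∈ (0,1)) with Fix a = {0,1} and Fix t ⊋ {0,1}, and suppose there exist y ∈ Fix t and z ∈ I ∖ Fix t with ∑_{i≥0} |aⁱ(y) − aⁱ(z)|^τ < ∞. Then τ < (√5 − 1)/2. -/

import Mathlib

open Set Filter Topology Function

/-- Mean value theorem on `[0,1]`, with one-sided derivatives and unordered endpoints. -/
lemma exists_mem_uIcc_sub_eq_mul_sub {f f' : ℝ → ℝ}
    (hf : ∀ x ∈ Icc (0:ℝ) 1, HasDerivWithinAt f (f' x) (Icc 0 1) x)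
    {x y : ℝ} (hx : x ∈ Icc (0:ℝ) 1) (hy : y ∈ Icc (0:ℝ) 1) :
    ∃ ξ ∈ uIcc x y, f x - f y = f' ξ * (x - y) := by
  have key : ∀ x ∈ Icc (0:ℝ) 1, ∀ y ∈ Icc (0:ℝ) 1, x < y →
      ∃ ξ ∈ Icc x y, f y - f x = f' ξ * (y - x) := by
    intro x hx y hy hxy
    have hsub : Icc x y ⊆ Icc (0:ℝ) 1 := Icc_subset_Icc hx.1 hy.2
    obtain ⟨ξ, hξ, h⟩ := exists_hasDerivAt_eq_slope f f' hxy
      (fun w hw => ((hf w (hsub hw)).continuousWithinAt).mono hsub)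
      (fun w hw => (hf w (hsub (Ioo_subset_Icc_self hw))).hasDerivAt
        (Icc_mem_nhds (hx.1.trans_lt hw.1) (hw.2.trans_le hy.2)))
    refine ⟨ξ, Ioo_subset_Icc_self hξ, ?_⟩
    rw [h, div_mul_cancel₀ _ (sub_pos.2 hxy).ne']
  rcases lt_trichotomy x y with h | h | h
  · obtain ⟨ξ, hξ, e⟩ := key x hx y hy h
    exact ⟨ξ, by rwa [uIcc_of_le h.le], by linarith⟩
  · exact ⟨x, left_mem_uIcc, by simp [h]⟩
  · obtain ⟨ξ, hξ, e⟩ := key y hy x hx h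
    exact ⟨ξ, by rwa [uIcc_of_ge h.le], e⟩

/-- A point moved by a continuous monotone map towards a fixed point converges to a fixed point
under iteration. -/
lemma exists_tendsto_iterate_mem_uIcc {s : ℝ → ℝ} (hs : Monotone s) (hc : Continuous s)
    {y z : ℝ} (hy : s y = y) (h : (y ≤ z ∧ s z ≤ z) ∨ (z ≤ y ∧ z ≤ s z)) :
    ∃ u ∈ uIcc y z, s u = u ∧ Tendsto (fun n => s^[n] z) atTop (𝓝 u) ∧
      ∀ n, s^[n] z ∈ uIcc y z := by
  have hyn : ∀ n, s^[n] y = y := fun n => iterate_fixed hy n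
  have hmem : ∀ n, s^[n] z ∈ uIcc y z := by
    intro n
    rcases h with ⟨h1, h2⟩ | ⟨h1, h2⟩
    · rw [uIcc_of_le h1]
      refine ⟨?_, hs.antitone_iterate_of_map_le h2 (Nat.zero_le n)⟩
      simpa [hyn n] using hs.iterate n h1
    · rw [uIcc_of_ge h1]
      refine ⟨hs.monotone_iterate_of_le_map h2 (Nat.zero_le n), ?_⟩
      simpa [hyn n] using hs.iterate n h1
  have hlim : ∃ u, Tendsto (fun n => s^[n] z) atTop (𝓝 u) := by
    rcases h with ⟨h1, h2⟩ | ⟨h1, h2⟩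
    · exact ⟨_, tendsto_atTop_ciInf (hs.antitone_iterate_of_map_le h2)
        ⟨min y z, by rintro _ ⟨n, rfl⟩; exact (hmem n).1⟩⟩
    · exact ⟨_, tendsto_atTop_ciSup (hs.monotone_iterate_of_le_map h2)
        ⟨max y z, by rintro _ ⟨n, rfl⟩; exact (hmem n).2⟩⟩
  obtain ⟨u, hu⟩ := hlim
  exact ⟨u, isClosed_Icc.mem_of_tendsto hu (Eventually.of_forall hmem),
    isFixedPt_of_tendsto_iterate hu hc.continuousAt, hu, hmem⟩

/-- If a monotone map fixes no point of `(0,1)`, all orbits in `(0,1)` converge to a common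
end point. -/
lemma exists_tendsto_iterate_endpoint {f : ℝ → ℝ} (hf : Monotone f) (hc : Continuous f)
    (h0 : f 0 = 0) (h1 : f 1 = 1) (hfix : ∀ x ∈ Ioo (0:ℝ) 1, f x ≠ x) :
    ∃ e, (e = 0 ∨ e = 1) ∧ ∀ x ∈ Ioo (0:ℝ) 1, Tendsto (fun n => f^[n] x) atTop (𝓝 e) := by
  have hsign : (∀ x ∈ Ioo (0:ℝ) 1, f x < x) ∨ (∀ x ∈ Ioo (0:ℝ) 1, x < f x) := by
    by_contra! hcon
    obtain ⟨⟨p, hp, hp'⟩, q, hq, hq'⟩ := hcon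
    obtain ⟨x, hx, hx'⟩ := isPreconnected_Ioo.intermediate_value₂ hq hp
      hc.continuousOn continuousOn_id hq' hp'
    exact hfix x hx hx'
  rcases hsign with h | h
  · refine ⟨0, Or.inl rfl, fun x hx => ?_⟩
    obtain ⟨u, hu, hfu, hlim, -⟩ :=
      exists_tendsto_iterate_mem_uIcc hf hc h0 (Or.inl ⟨hx.1.le, (h x hx).le⟩)
    rw [uIcc_of_le hx.1.le] at hu
    rcases hu.1.eq_or_lt with e | e
    · rwa [e]
    · exact absurd hfu (hfix u ⟨e, hu.2.trans_lt hx.2⟩)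
  · refine ⟨1, Or.inr rfl, fun x hx => ?_⟩
    obtain ⟨u, hu, hfu, hlim, -⟩ :=
      exists_tendsto_iterate_mem_uIcc hf hc h1 (Or.inr ⟨hx.2.le, (h x hx).le⟩)
    rw [uIcc_of_ge hx.2.le] at hu
    rcases hu.2.eq_or_lt with e | e
    · rwa [← e]
    · exact absurd hfu (hfix u ⟨hx.1.trans_le hu.1, e⟩)

lemma continuousOn_of_abs_sub_le_rpow {g : ℝ → ℝ} {s : Set ℝ} {H τ : ℝ} (hτ : 0 < τ)
    (hg : ∀ x ∈ s, ∀ y ∈ s, |g x - g y| ≤ H * |x - y| ^ τ) : ContinuousOn g s := by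
  intro x hx
  rw [ContinuousWithinAt, tendsto_iff_dist_tendsto_zero]
  have hlim : Tendsto (fun y => H * |y - x| ^ τ) (𝓝[s] x) (𝓝 0) := by
    have hcont : Continuous fun y : ℝ => H * |y - x| ^ τ :=
      continuous_const.mul ((continuous_id.sub continuous_const).abs.rpow_const
        fun _ => Or.inr hτ.le)
    have := (hcont.tendsto x).mono_left (nhdsWithin_le_nhds (s := s))
    simpa [Real.zero_rpow hτ.ne'] using this
  refine squeeze_zero' (Eventually.of_forall fun _ => dist_nonneg) ?_ hlim
  filter_upwards [self_mem_nhdsWithin] with y hy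
  simpa [Real.dist_eq] using hg y hy x hx

lemma iterate_mem_uIcc {f : ℝ → ℝ} (hf : Monotone f) {y z w : ℝ} (hw : w ∈ uIcc y z) (n : ℕ) :
    f^[n] w ∈ uIcc (f^[n] y) (f^[n] z) :=
  (hf.iterate n).mapsTo_uIcc hw

/-- Bounded distortion of the iterates of `f` along an interval whose images have summable
`τ`-th powers of lengths. -/
lemma exists_iterate_distortion_bound {f f' : ℝ → ℝ} {τ H y z : ℝ} (hτ : 0 < τ)
    (hf : Monotone f) (hmaps : MapsTo f (Icc 0 1) (Icc 0 1))
    (hf' : ∀ x ∈ Icc (0:ℝ) 1, HasDerivWithinAt f (f' x) (Icc 0 1) x)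
    (hpos : ∀ x ∈ Icc (0:ℝ) 1, 0 < f' x)
    (hH : ∀ x ∈ Icc (0:ℝ) 1, ∀ y ∈ Icc (0:ℝ) 1, |f' x - f' y| ≤ H * |x - y| ^ τ)
    (hy : y ∈ Icc (0:ℝ) 1) (hz : z ∈ Icc (0:ℝ) 1)
    (hsum : Summable fun i : ℕ => |f^[i] y - f^[i] z| ^ τ) :
    ∃ E : ℝ, ∀ u ∈ uIcc y z, ∀ w ∈ uIcc y z, ∀ n,
      |f^[n] w - f^[n] u| * |z - u| ≤ E * (|f^[n] z - f^[n] u| * |w - u|) := by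
  obtain ⟨x₀, hx₀, hmin⟩ := isCompact_Icc.exists_isMinOn (nonempty_Icc.2 zero_le_one)
    (continuousOn_of_abs_sub_le_rpow hτ hH)
  have hm : 0 < f' x₀ := hpos x₀ hx₀
  set C := |H| / f' x₀ with hC
  have hC0 : 0 ≤ C := by positivity
  set L : ℕ → ℝ := fun i => |f^[i] y - f^[i] z| ^ τ with hL
  have hL0 : ∀ i, 0 ≤ L i := fun i => Real.rpow_nonneg (abs_nonneg _) _
  have hsub : ∀ n, uIcc (f^[n] y) (f^[n] z) ⊆ Icc 0 1 := fun n =>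
    ordConnected_Icc.uIcc_subset (hmaps.iterate n hy) (hmaps.iterate n hz)
  refine ⟨Real.exp (C * ∑' i, L i), fun u hu w hw n => ?_⟩
  have hpartial : ∀ n, |f^[n] w - f^[n] u| * |z - u| ≤
      Real.exp (C * ∑ i ∈ Finset.range n, L i) * (|f^[n] z - f^[n] u| * |w - u|) := by
    intro n
    induction n with
    | zero => simp [mul_comm]
    | succ n ih =>
      have hun := iterate_mem_uIcc hf hu n
      have hwn := iterate_mem_uIcc hf hw n
      have hzn : f^[n] z ∈ uIcc (f^[n] y) (f^[n] z) := right_mem_uIcc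
      obtain ⟨ξ, hξ, e₁⟩ := exists_mem_uIcc_sub_eq_mul_sub hf' (hsub n hwn) (hsub n hun)
      obtain ⟨η, hη, e₂⟩ := exists_mem_uIcc_sub_eq_mul_sub hf' (hsub n hzn) (hsub n hun)
      have hξ' := uIcc_subset_uIcc hwn hun hξ
      have hη' := uIcc_subset_uIcc hzn hun hη
      have hdist : |ξ - η| ≤ |f^[n] y - f^[n] z| :=
        (abs_sub_le_of_uIcc_subset_uIcc (uIcc_subset_uIcc hη' hξ')).trans
          (abs_sub_comm _ _).le
      have hstep : f' ξ ≤ Real.exp (C * L n) * f' η := by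
        have hη0 : 0 < f' η := hpos η (hsub n hη')
        have h1 : f' ξ - f' η ≤ |H| * L n := calc
          f' ξ - f' η ≤ |f' ξ - f' η| := le_abs_self _
          _ ≤ H * |ξ - η| ^ τ := hH ξ (hsub n hξ') η (hsub n hη')
          _ ≤ |H| * |ξ - η| ^ τ := by gcongr; exact le_abs_self H
          _ ≤ |H| * L n := mul_le_mul_of_nonneg_left
              (Real.rpow_le_rpow (abs_nonneg _) hdist hτ.le) (abs_nonneg H)
        have h2 : |H| * L n ≤ C * L n * f' η := by
          have hmη : f' x₀ ≤ f' η := hmin (hsub n hη')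
          calc |H| * L n = C * L n * f' x₀ := by rw [hC]; field_simp
            _ ≤ C * L n * f' η := mul_le_mul_of_nonneg_left hmη (mul_nonneg hC0 (hL0 n))
        have h3 := mul_le_mul_of_nonneg_right (Real.add_one_le_exp (C * L n)) hη0.le
        linarith
      have hξ0 := hpos ξ (hsub n hξ')
      have hη0 := hpos η (hsub n hη')
      rw [iterate_succ_apply', iterate_succ_apply', iterate_succ_apply', e₁, e₂, abs_mul, abs_mul,
        abs_of_pos hξ0, abs_of_pos hη0, Finset.sum_range_succ, mul_add, Real.exp_add]
      calc f' ξ * |f^[n] w - f^[n] u| * |z - u|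
          = f' ξ * (|f^[n] w - f^[n] u| * |z - u|) := by ring
        _ ≤ (Real.exp (C * L n) * f' η) * (Real.exp (C * ∑ i ∈ Finset.range n, L i) *
            (|f^[n] z - f^[n] u| * |w - u|)) := by gcongr
        _ = _ := by ring
  refine (hpartial n).trans ?_
  gcongr
  exact hsum.sum_le_tsum _ fun i _ => hL0 i

/-- A Kopell-type lemma: a map commuting with `f`, with derivative `1` at the limit of the
`f`-orbits, cannot contract an interval whose `f`-images have summable `τ`-th powers of lengths. -/
lemma not_tendsto_of_summable_iterate {f f' t t' : ℝ → ℝ} {τ H e y z u : ℝ} {w : ℕ → ℝ}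
    (hτ : 0 < τ) (hf : StrictMono f) (hmaps : MapsTo f (Icc 0 1) (Icc 0 1))
    (hf' : ∀ x ∈ Icc (0:ℝ) 1, HasDerivWithinAt f (f' x) (Icc 0 1) x)
    (hpos : ∀ x ∈ Icc (0:ℝ) 1, 0 < f' x)
    (hH : ∀ x ∈ Icc (0:ℝ) 1, ∀ y ∈ Icc (0:ℝ) 1, |f' x - f' y| ≤ H * |x - y| ^ τ)
    (hcomm : Function.Commute f t)
    (ht' : ∀ x ∈ Icc (0:ℝ) 1, HasDerivWithinAt t (t' x) (Icc 0 1) x)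
    (htc : ContinuousOn t' (Icc 0 1)) (he : e ∈ Icc (0:ℝ) 1) (hte : t' e = 1)
    (hy : y ∈ Icc (0:ℝ) 1) (hz : z ∈ Icc (0:ℝ) 1)
    (hlim : Tendsto (fun n => f^[n] z) atTop (𝓝 e))
    (hsum : Summable fun i : ℕ => |f^[i] y - f^[i] z| ^ τ)
    (hu : u ∈ uIcc y z) (htu : t u = u) (hw0 : w 0 = z) (hw : ∀ j, w j ∈ uIcc y z)
    (hwu : ∀ j, w j ≠ u)
    (hstep : (∀ j, w (j + 1) = t (w j)) ∨ (∀ j, w j = t (w (j + 1)))) :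
    ¬ Tendsto w atTop (𝓝 u) := by
  intro hwlim
  have hsub : ∀ n, uIcc (f^[n] y) (f^[n] z) ⊆ Icc 0 1 := fun n =>
    ordConnected_Icc.uIcc_subset (hmaps.iterate n hy) (hmaps.iterate n hz)
  have hlen : Tendsto (fun n => |f^[n] y - f^[n] z|) atTop (𝓝 0) := by
    have h := hsum.tendsto_atTop_zero.rpow_const (p := τ⁻¹) (Or.inr (inv_nonneg.2 hτ.le))
    simpa [Real.zero_rpow (inv_ne_zero hτ.ne'), Real.rpow_rpow_inv (abs_nonneg _) hτ.ne'] using h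
  have hX : ∀ n x, x ≠ u → |f^[n] x - f^[n] u| ≠ 0 := fun n x hx =>
    abs_ne_zero.2 (sub_ne_zero.2 ((hf.injective.iterate n).ne hx))
  have hone : ∀ x ∈ uIcc y z, x ≠ u →
      Tendsto (fun n => |f^[n] (t x) - f^[n] u| / |f^[n] x - f^[n] u|) atTop (𝓝 1) := by
    intro x hx hxu
    have hmv : ∀ n, ∃ ξ ∈ uIcc (f^[n] y) (f^[n] z),
        t (f^[n] x) - t (f^[n] u) = t' ξ * (f^[n] x - f^[n] u) := by
      intro n
      have hxn := iterate_mem_uIcc hf.monotone hx n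
      have hun := iterate_mem_uIcc hf.monotone hu n
      obtain ⟨ξ, hξ, h⟩ := exists_mem_uIcc_sub_eq_mul_sub ht' (hsub n hxn) (hsub n hun)
      exact ⟨ξ, uIcc_subset_uIcc hxn hun hξ, h⟩
    choose ξ hξ hξe using hmv
    have hξlim : Tendsto ξ atTop (𝓝 e) := by
      have h0 : Tendsto (fun n => ξ n - f^[n] z) atTop (𝓝 0) := by
        refine squeeze_zero_norm (fun n => ?_) hlen
        rw [Real.norm_eq_abs, abs_sub_comm (f^[n] y), abs_sub_comm]
        exact abs_sub_right_of_mem_uIcc (hξ n)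
      simpa using h0.add hlim
    have hξ' : Tendsto ξ atTop (𝓝[Icc 0 1] e) :=
      tendsto_nhdsWithin_iff.2 ⟨hξlim, Eventually.of_forall fun n => hsub n (hξ n)⟩
    have hlim1 := ((htc e he).tendsto.comp hξ').abs
    rw [hte, abs_one] at hlim1
    refine hlim1.congr fun n => ?_
    have h1 : f^[n] (t x) = t (f^[n] x) := hcomm.iterate_left n x
    have h2 : f^[n] u = t (f^[n] u) := by
      conv_lhs => rw [← htu]
      exact hcomm.iterate_left n u
    rw [h1, eq_div_iff (hX n x hxu), Function.comp_apply, ← abs_mul, ← hξe n, ← h2]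
  have hall : ∀ j, Tendsto (fun n => |f^[n] (w j) - f^[n] u| / |f^[n] z - f^[n] u|)
      atTop (𝓝 1) := by
    have hzu : z ≠ u := hw0 ▸ hwu 0
    intro j
    induction j with
    | zero =>
      refine tendsto_const_nhds.congr fun n => ?_
      rw [hw0, div_self (hX n z hzu)]
    | succ j ih =>
      have hnext : Tendsto (fun n => |f^[n] (w (j + 1)) - f^[n] u| / |f^[n] (w j) - f^[n] u|)
          atTop (𝓝 1) := by
        rcases hstep with h | h
        · rw [h j]
          exact hone _ (hw j) (hwu j)
        · have := (hone _ (hw (j + 1)) (hwu (j + 1))).inv₀ one_ne_zero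
          rw [← h j] at this
          simpa using this
      have := hnext.mul ih
      rw [one_mul] at this
      refine this.congr fun n => ?_
      exact div_mul_div_cancel₀ (hX n _ (hwu j))
  obtain ⟨E, hE⟩ :=
    exists_iterate_distortion_bound hτ hf.monotone hmaps hf' hpos hH hy hz hsum
  have hzu : z ≠ u := hw0 ▸ hwu 0
  have hzu0 : 0 < |z - u| := abs_pos.2 (sub_ne_zero.2 hzu)
  have hbound : ∀ j, |z - u| ≤ E * |w j - u| := by
    intro j
    refine le_of_tendsto (x := atTop)
      (by simpa using (hall j).mul_const |z - u|) (Eventually.of_forall fun n => ?_)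
    have h0 : 0 < |f^[n] z - f^[n] u| := (abs_nonneg _).lt_of_ne' (hX n z hzu)
    have := hE u hu (w j) (hw j) n
    rw [div_mul_eq_mul_div, div_le_iff₀ h0]
    linarith
  have hzero : Tendsto (fun j => E * |w j - u|) atTop (𝓝 0) := by
    have := ((hwlim.sub_const u).abs).const_mul E
    simpa using this
  exact absurd (ge_of_tendsto' hzero hbound) (not_le.2 hzu0)

/-- if `ℤ² = ⟨a,t⟩` acts faithfully on `[0,1]` by
orientation-preserving `C^{1,τ}` diffeomorphisms with `Fix a = {0,1}`,
`Fix t ⊋ {0,1}`, and there are `y ∈ Fix t`, `z ∉ Fix t` with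
`∑ᵢ |aⁱ(y) − aⁱ(z)|^τ < ∞`, then `τ < (√5 − 1)/2`. -/
theorem stmt13 (τ : ℝ) (hτ0 : 0 < τ) (hτ1 : τ < 1)
    (a t : Equiv.Perm ℝ)
    (ha_mono : StrictMono (a : ℝ → ℝ)) (ht_mono : StrictMono (t : ℝ → ℝ))
    (ha_id : ∀ x, x ∉ Set.Icc (0:ℝ) 1 → a x = x)
    (ht_id : ∀ x, x ∉ Set.Icc (0:ℝ) 1 → t x = x)
    (hcomm : a * t = t * a)
    (hfaithful : ∀ m n : ℤ, a ^ m * t ^ n = 1 → m = 0 ∧ n = 0)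
    (ha_fix : {x ∈ Set.Icc (0:ℝ) 1 | a x = x} = {0, 1})
    (ht_fix : ({0, 1} : Set ℝ) ⊂ {x ∈ Set.Icc (0:ℝ) 1 | t x = x})
    (a' t' : ℝ → ℝ)
    (ha' : ∀ x ∈ Set.Icc (0:ℝ) 1, HasDerivWithinAt (a : ℝ → ℝ) (a' x) (Set.Icc 0 1) x)
    (ht' : ∀ x ∈ Set.Icc (0:ℝ) 1, HasDerivWithinAt (t : ℝ → ℝ) (t' x) (Set.Icc 0 1) x)
    (ha'pos : ∀ x ∈ Set.Icc (0:ℝ) 1, 0 < a' x)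
    (ht'pos : ∀ x ∈ Set.Icc (0:ℝ) 1, 0 < t' x)
    (Ha Ht : ℝ)
    (ha'h : ∀ x ∈ Set.Icc (0:ℝ) 1, ∀ y ∈ Set.Icc (0:ℝ) 1,
      |a' x - a' y| ≤ Ha * |x - y| ^ τ)
    (ht'h : ∀ x ∈ Set.Icc (0:ℝ) 1, ∀ y ∈ Set.Icc (0:ℝ) 1,
      |t' x - t' y| ≤ Ht * |x - y| ^ τ)
    (y z : ℝ) (hy : y ∈ Set.Icc (0:ℝ) 1) (hz : z ∈ Set.Icc (0:ℝ) 1)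
    (hyfix : t y = y) (hzfix : t z ≠ z)
    (hsum : Summable (fun i : ℕ => |(a ^ i) y - (a ^ i) z| ^ τ)) :
    τ < (Real.sqrt 5 - 1) / 2 := by
  exfalso
  have hac : Continuous a := ha_mono.monotone.continuous_of_surjective a.surjective
  have htc : Continuous t := ht_mono.monotone.continuous_of_surjective t.surjective
  have hsc : Continuous t.symm :=
    (show StrictMono t.symm from fun x y h => ht_mono.lt_iff_lt.1 (by simpa using h)).monotone
      |>.continuous_of_surjective t.symm.surjective
  have hs_mono : Monotone t.symm := fun x y h => ht_mono.le_iff_le.1 (by simpa using h)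
  have ha_fix' : ∀ x ∈ Icc (0:ℝ) 1, a x = x ↔ x = 0 ∨ x = 1 := fun x hx => by
    have := Set.ext_iff.1 ha_fix x
    simpa [hx.1, hx.2] using this
  have ha0 : a 0 = 0 := (ha_fix' 0 (by simp)).2 (Or.inl rfl)
  have ha1 : a 1 = 1 := (ha_fix' 1 (by simp)).2 (Or.inr rfl)
  have ht0 : t 0 = 0 := (ht_fix.1 (by simp : (0:ℝ) ∈ ({0, 1} : Set ℝ))).2
  have ht1 : t 1 = 1 := (ht_fix.1 (by simp : (1:ℝ) ∈ ({0, 1} : Set ℝ))).2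
  obtain ⟨p, ⟨hp, hpt⟩, hp01⟩ := Set.exists_of_ssubset ht_fix
  have hIoo : ∀ x ∈ Icc (0:ℝ) 1, x ≠ 0 → x ≠ 1 → x ∈ Ioo (0:ℝ) 1 := fun x hx h0 h1 =>
    ⟨lt_of_le_of_ne hx.1 h0.symm, lt_of_le_of_ne hx.2 h1⟩
  have hpI : p ∈ Ioo (0:ℝ) 1 :=
    hIoo p hp (fun h => hp01 (by simp [h])) (fun h => hp01 (by simp [h]))
  have hzI : z ∈ Ioo (0:ℝ) 1 :=
    hIoo z hz (fun h => hzfix (by rw [h, ht0])) (fun h => hzfix (by rw [h, ht1]))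
  obtain ⟨e, he01, helim⟩ := exists_tendsto_iterate_endpoint ha_mono.monotone hac ha0 ha1
    (fun x hx h => ((ha_fix' x (Ioo_subset_Icc_self hx)).1 h).elim hx.1.ne' hx.2.ne)
  have he : e ∈ Icc (0:ℝ) 1 := by rcases he01 with rfl | rfl <;> simp
  have hae : a e = e := (ha_fix' e he).2 he01
  have hte : t e = e := by rcases he01 with rfl | rfl <;> assumption
  have hpe : p ≠ e := by
    rcases he01 with rfl | rfl
    exacts [hpI.1.ne', hpI.2.ne]
  have hmaps : MapsTo a (Icc 0 1) (Icc 0 1) := fun x hx =>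
    ⟨ha0 ▸ ha_mono.monotone hx.1, ha1 ▸ ha_mono.monotone hx.2⟩
  have hcomm' : Function.Commute a t := fun x => by
    have := congrArg (fun g : Equiv.Perm ℝ => g x) hcomm
    simpa using this
  -- `t` fixes the points `aⁿ p`, which accumulate at `e`
  have ht'e : t' e = 1 := by
    have hne : ∀ n, a^[n] p ≠ e := fun n h =>
      hpe (a.injective.iterate n (h.trans (iterate_fixed hae n).symm))
    have hseq : Tendsto (fun n => a^[n] p) atTop (𝓝[Icc 0 1 \ {e}] e) :=
      tendsto_nhdsWithin_iff.2 ⟨helim p hpI,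
        Eventually.of_forall fun n => ⟨hmaps.iterate n hp, hne n⟩⟩
    have hslope := (hasDerivWithinAt_iff_tendsto_slope.1 (ht' e he)).comp hseq
    refine tendsto_nhds_unique hslope (tendsto_const_nhds.congr fun n => ?_)
    have h1 : t (a^[n] p) = a^[n] p := by
      rw [← hcomm'.iterate_left n p, hpt]
    rw [Function.comp_apply, slope_def_field, h1, hte, div_self (sub_ne_zero.2 (hne n))]
  have hsum' : Summable fun i : ℕ => |a^[i] y - a^[i] z| ^ τ := by
    simpa [Equiv.Perm.iterate_eq_pow] using hsum
  have hyz : y ≠ z := fun h => hzfix (h ▸ hyfix)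
  have hsy : t.symm y = y := t.symm_apply_eq.2 hyfix.symm
  by_cases hdir : (y ≤ z ∧ t z ≤ z) ∨ (z ≤ y ∧ z ≤ t z)
  · obtain ⟨u, hu, htu, hlim, hmem⟩ :=
      exists_tendsto_iterate_mem_uIcc ht_mono.monotone htc hyfix hdir
    refine not_tendsto_of_summable_iterate hτ0 ha_mono hmaps ha' ha'pos ha'h hcomm' ht'
      (continuousOn_of_abs_sub_le_rpow hτ0 ht'h) he ht'e hy hz (helim z hzI) hsum' hu htu rfl hmem
      (fun j h => ?_) (Or.inl fun j => iterate_succ_apply' _ _ _) hlim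
    have : z = u := t.injective.iterate j (h.trans (iterate_fixed htu j).symm)
    exact hzfix (this ▸ htu)
  · have hdir' : (y ≤ z ∧ t.symm z ≤ z) ∨ (z ≤ y ∧ z ≤ t.symm z) := by
      push Not at hdir
      rcases le_total y z with h | h
      · refine Or.inl ⟨h, ht_mono.le_iff_le.1 ?_⟩
        simpa using (hdir.1 h).le
      · refine Or.inr ⟨h, ht_mono.le_iff_le.1 ?_⟩
        simpa using (hdir.2 h).le
    obtain ⟨u, hu, hsu, hlim, hmem⟩ :=
      exists_tendsto_iterate_mem_uIcc hs_mono hsc hsy hdir'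
    have htu : t u = u := (t.symm_apply_eq.1 hsu).symm
    refine not_tendsto_of_summable_iterate hτ0 ha_mono hmaps ha' ha'pos ha'h hcomm' ht'
      (continuousOn_of_abs_sub_le_rpow hτ0 ht'h) he ht'e hy hz (helim z hzI) hsum' hu htu rfl hmem
      (fun j h => ?_) (Or.inr fun j => ?_) hlim
    · have : z = u := t.symm.injective.iterate j (h.trans (iterate_fixed hsu j).symm)
      exact hzfix (this ▸ htu)
    · rw [iterate_succ_apply', t.apply_symm_apply]
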